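/- There exist constants c₁ > 0 and c₂ > 0 depending only on the dimension d such that for every β > 0 and every integer N ≥ 2, the kernel K_{>N,β} satisfies c₁ · (1 + β N²)^{-1} · (log(N+2))^d ≤ ‖K_{>N,β}‖_{L¹(𝕋^d)} ≤ c₂ · (1 + β N²)^{-1} · (log(N+2))^d. -/

import Mathlib

open MeasureTheory

noncomputable section

/-- The fundamental domain `[0,1)^d` of the torus `𝕋^d = (ℝ/ℤ)^d`. -/
def torusBox (d : ℕ) : Set (Fin d → ℝ) :=
  Set.univ.pi fun _ => Set.Ico (0 : ℝ) 1

/-- The character `e^{2πi k·x}` on `𝕋^d`. -/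
def torusChar (d : ℕ) (k : Fin d → ℤ) (x : Fin d → ℝ) : ℂ :=
  Complex.exp (2 * Real.pi * Complex.I * (∑ i, (k i : ℝ) * x i))

/-- The one-dimensional character `e^{2πikx}`. -/
def expChar (k : ℤ) (x : ℝ) : ℂ := Complex.exp (2 * Real.pi * Complex.I * (k * x))

lemma expChar_eq (k : ℤ) (x : ℝ) :
    expChar k x = Complex.exp (((2 * Real.pi * (k * x) : ℝ) : ℂ) * Complex.I) := by
  unfold expChar; congr 1; push_cast; ring

@[simp] lemma norm_expChar (k : ℤ) (x : ℝ) : ‖expChar k x‖ = 1 := by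
  rw [expChar_eq, Complex.norm_exp_ofReal_mul_I]

@[simp] lemma expChar_zero (x : ℝ) : expChar 0 x = 1 := by simp [expChar]

lemma expChar_add (k l : ℤ) (x : ℝ) : expChar (k + l) x = expChar k x * expChar l x := by
  rw [expChar, expChar, expChar, ← Complex.exp_add]; congr 1; push_cast; ring

lemma expChar_pow (k : ℤ) (n : ℕ) (x : ℝ) : expChar k x ^ n = expChar (n * k) x := by
  rw [expChar, expChar, ← Complex.exp_nat_mul]; congr 1; push_cast; ring

lemma expChar_add_int (k m : ℤ) (x : ℝ) : expChar k (x + m) = expChar k x := by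
  rw [expChar, expChar]
  have : (2 * Real.pi * Complex.I * (k * ((x + m : ℝ) : ℂ)) : ℂ)
      = 2 * Real.pi * Complex.I * (k * x) + ((k * m : ℤ) : ℂ) * (2 * Real.pi * Complex.I) := by
    push_cast; ring
  rw [this, Complex.exp_periodic.int_mul]

lemma expChar_one_sub (k : ℤ) (x : ℝ) : expChar k (1 - x) = expChar (-k) x := by
  have := expChar_add_int k 1 (-x)
  rw [show (1 - x : ℝ) = -x + (1 : ℤ) by push_cast; ring, this, expChar, expChar]
  congr 1; push_cast; ring

@[fun_prop] lemma continuous_expChar (k : ℤ) : Continuous (expChar k) := by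
  unfold expChar; fun_prop

lemma torusChar_eq_prod (d : ℕ) (k : Fin d → ℤ) (x : Fin d → ℝ) :
    torusChar d k x = ∏ i, expChar (k i) (x i) := by
  simp only [torusChar, expChar, ← Complex.exp_sum, ← Finset.mul_sum]
  push_cast; rfl

lemma norm_torusChar (d : ℕ) (k : Fin d → ℤ) (x : Fin d → ℝ) : ‖torusChar d k x‖ = 1 := by
  rw [torusChar_eq_prod, norm_prod]; simp

lemma continuous_torusChar (d : ℕ) (k : Fin d → ℤ) : Continuous (torusChar d k) := by
  unfold torusChar; fun_prop

lemma integral_expChar (k : ℤ) :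
    ∫ x in Set.Ico (0 : ℝ) 1, expChar k x = if k = 0 then 1 else 0 := by
  rw [integral_Ico_eq_integral_Ioc, ← intervalIntegral.integral_of_le zero_le_one]
  split_ifs with hk
  · subst hk; simp
  · have hc : (2 * Real.pi * Complex.I * k : ℂ) ≠ 0 := by
      simp [Real.pi_ne_zero, hk]
    have := integral_exp_mul_complex (a := 0) (b := 1) hc
    simp only [expChar, ← mul_assoc]
    rw [this]
    have h1 : Complex.exp (2 * Real.pi * Complex.I * k * (1 : ℝ)) = 1 := by
      rw [Complex.ofReal_one, mul_one, mul_comm]; exact Complex.exp_int_mul_two_pi_mul_I k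
    rw [h1]; simp

lemma four_mul_le_norm_expChar_one_sub_one {y : ℝ} (h0 : 0 ≤ y) (h1 : y ≤ 1 / 2) :
    4 * y ≤ ‖expChar 1 y - 1‖ := by
  have : expChar 1 y = Complex.exp (Complex.I * ((2 * Real.pi * y : ℝ) : ℂ)) := by
    unfold expChar; congr 1; push_cast; ring
  rw [this, Complex.norm_exp_I_mul_ofReal_sub_one, Real.norm_eq_abs]
  have hs := Real.mul_le_sin (x := 2 * Real.pi * y / 2) (by positivity)
    (by nlinarith [Real.pi_pos])
  have : 2 / Real.pi * (2 * Real.pi * y / 2) = 2 * y := by field_simp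
  rw [this] at hs
  exact le_trans (by linarith) (le_abs_self _)

lemma norm_sum_range_expChar_le {y : ℝ} (h0 : 0 < y) (h1 : y ≤ 1 / 2) (a : ℤ) (n : ℕ) :
    ‖∑ j ∈ Finset.range n, expChar (a + j) y‖ ≤ 1 / (2 * y) := by
  have h4 := four_mul_le_norm_expChar_one_sub_one h0.le h1
  have hne : expChar 1 y ≠ 1 := by
    intro h; rw [h] at h4; simp at h4; linarith
  have : ∑ j ∈ Finset.range n, expChar (a + j) y
      = expChar a y * ((expChar 1 y ^ n - 1) / (expChar 1 y - 1)) := by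
    rw [← geom_sum_eq hne, Finset.mul_sum]
    refine Finset.sum_congr rfl fun j _ => ?_
    rw [expChar_add, expChar_pow, mul_one]
  rw [this, norm_mul, norm_expChar, one_mul, norm_div, div_le_div_iff₀ (by linarith) (by linarith)]
  have : ‖expChar 1 y ^ n - 1‖ ≤ 2 := by
    refine (norm_sub_le _ _).trans ?_
    rw [norm_pow, norm_expChar]; norm_num
  nlinarith

/-- The Dirichlet kernel `∑_{|k| ≤ n} e^{2πikx}`. -/
def dirichletKernel (n : ℕ) (x : ℝ) : ℂ := ∑ k ∈ Finset.Icc (-n : ℤ) n, expChar k x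

@[fun_prop] lemma continuous_dirichletKernel (n : ℕ) : Continuous (dirichletKernel n) := by
  unfold dirichletKernel; fun_prop

lemma sum_Icc_neg_eq_sum_range {M : Type*} [AddCommGroup M] (f : ℤ → M) (n : ℕ) :
    ∑ k ∈ Finset.Icc (-n : ℤ) n, f k = ∑ j ∈ Finset.range (2 * n + 1), f (-n + j) := by
  symm
  refine Finset.sum_bij (fun j _ => -(n : ℤ) + j) ?_ ?_ ?_ ?_
  · intro j hj; simp at hj ⊢; omega
  · intro a _ b _ h; simpa using h
  · intro b hb
    simp at hb
    exact ⟨(b + n).toNat, by simp; omega, by omega⟩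
  · intros; rfl

lemma norm_dirichletKernel_le (n : ℕ) (x : ℝ) : ‖dirichletKernel n x‖ ≤ 2 * n + 1 := by
  unfold dirichletKernel
  refine (norm_sum_le _ _).trans ?_
  simp
  have : ((n : ℤ) + 1 + n).toNat = 2 * n + 1 := by omega
  rw [this]; push_cast; rfl

lemma norm_dirichletKernel_le_inv {y : ℝ} (h0 : 0 < y) (h1 : y ≤ 1 / 2) (n : ℕ) :
    ‖dirichletKernel n y‖ ≤ 1 / (2 * y) := by
  unfold dirichletKernel
  rw [sum_Icc_neg_eq_sum_range]
  exact norm_sum_range_expChar_le h0 h1 _ _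

lemma dirichletKernel_one_sub (n : ℕ) (x : ℝ) :
    dirichletKernel n (1 - x) = dirichletKernel n x := by
  unfold dirichletKernel
  refine Finset.sum_bij (fun k _ => -k) ?_ ?_ ?_ ?_
  · intro j hj; simp at hj ⊢; omega
  · intro a _ b _ h; simpa using h
  · intro b hb; simp at hb; exact ⟨-b, by simp; omega, by simp⟩
  · intro k _; exact expChar_one_sub k x

lemma norm_dirichletKernel_le_div {y : ℝ} (h0 : 0 ≤ y) (h1 : y ≤ 1 / 2) (n : ℕ) :
    ‖dirichletKernel n y‖ ≤ 2 / (1 / (2 * n + 1) + 2 * y) := by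
  rw [le_div_iff₀ (by positivity), mul_add]
  have ha : ‖dirichletKernel n y‖ * (1 / (2 * n + 1)) ≤ 1 := by
    rw [mul_one_div, div_le_one (by positivity)]; exact norm_dirichletKernel_le n y
  have hb : ‖dirichletKernel n y‖ * (2 * y) ≤ 1 := by
    rcases h0.eq_or_lt with rfl | h0
    · simp
    · have := norm_dirichletKernel_le_inv h0 h1 n
      rwa [le_div_iff₀ (by positivity)] at this
  linarith

lemma integral_two_div_add_two_mul {ε : ℝ} (hε : 0 < ε) :
    ∫ y in (0 : ℝ)..1, 2 / (ε + 2 * y) = Real.log ((ε + 2) / ε) := by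
  rw [intervalIntegral.integral_eq_sub_of_hasDerivAt (f := fun y => Real.log (ε + 2 * y))]
  · rw [Real.log_div (by positivity) hε.ne']; simp
  · intro y hy
    simp at hy
    have h : HasDerivAt (fun y : ℝ => ε + 2 * y) 2 y := by
      simpa using ((hasDerivAt_id y).const_mul 2).const_add ε
    exact h.log (by nlinarith [hy.1])
  · refine ContinuousOn.intervalIntegrable ?_
    refine ContinuousOn.div (by fun_prop) (by fun_prop) ?_
    intro y hy
    simp at hy
    nlinarith [hy.1]

lemma integral_norm_dirichletKernel_le (n : ℕ) :
    ∫ x in Set.Ico (0 : ℝ) 1, ‖dirichletKernel n x‖ ≤ 4 * Real.log (n + 2) := by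
  rw [integral_Ico_eq_integral_Ioc, ← intervalIntegral.integral_of_le zero_le_one]
  set ε : ℝ := 1 / (2 * n + 1) with hε
  have hε0 : 0 < ε := by positivity
  have hc : ContinuousOn (fun y : ℝ => 2 / (ε + 2 * y)) (Set.Icc 0 1) := by
    refine ContinuousOn.div (by fun_prop) (by fun_prop) ?_
    intro y hy
    nlinarith [hy.1]
  have hi : IntervalIntegrable (fun y : ℝ => 2 / (ε + 2 * y)) volume 0 1 :=
    ContinuousOn.intervalIntegrable (by simpa using hc)
  have hi' : IntervalIntegrable (fun y : ℝ => 2 / (ε + 2 * (1 - y))) volume 0 1 := by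
    simpa using (hi.comp_sub_left 1).symm
  calc ∫ x in (0 : ℝ)..1, ‖dirichletKernel n x‖
      ≤ ∫ x in (0 : ℝ)..1, (2 / (ε + 2 * x) + 2 / (ε + 2 * (1 - x))) := by
        refine intervalIntegral.integral_mono_on zero_le_one
          (Continuous.intervalIntegrable (by fun_prop) _ _) (hi.add hi') ?_
        intro x hx
        have p1 : 0 ≤ 2 / (ε + 2 * x) := div_nonneg (by norm_num) (by linarith [hx.1])
        have p2 : 0 ≤ 2 / (ε + 2 * (1 - x)) := div_nonneg (by norm_num) (by linarith [hx.2])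
        rcases le_total x (1 / 2) with h | h
        · linarith [norm_dirichletKernel_le_div hx.1 h n]
        · have := norm_dirichletKernel_le_div (y := 1 - x) (by linarith [hx.2]) (by linarith) n
          rw [dirichletKernel_one_sub] at this
          linarith
    _ = 2 * Real.log ((ε + 2) / ε) := by
        rw [intervalIntegral.integral_add hi hi',
          intervalIntegral.integral_comp_sub_left (fun y => 2 / (ε + 2 * y)) 1]
        simp only [sub_self, sub_zero]
        rw [integral_two_div_add_two_mul hε0]; ring
    _ ≤ 2 * Real.log ((n + 2) ^ 2) := by
        gcongr
        rw [hε]; field_simp; nlinarith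
    _ = 4 * Real.log (n + 2) := by rw [Real.log_pow]; push_cast; ring

/-! ### Summation by parts -/

lemma sum_smul_sub_by_parts {E : Type*} [AddCommGroup E] [Module ℝ E] (b : ℕ → ℝ) (D : ℕ → E)
    {m n : ℕ} (h : m ≤ n) :
    ∑ k ∈ Finset.Ico m n, b (k + 1) • (D (k + 1) - D k)
      = b n • D n - b m • D m + ∑ k ∈ Finset.Ico m n, (b k - b (k + 1)) • D k := by
  induction n, h using Nat.le_induction with
  | base => simp
  | succ n h ih =>
    rw [Finset.sum_Ico_succ_top h, Finset.sum_Ico_succ_top h, ih]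
    module

lemma norm_sum_smul_sub_le {E : Type*} [NormedAddCommGroup E] [NormedSpace ℝ E] {b : ℕ → ℝ}
    {m n : ℕ} (hb : ∀ k, m ≤ k → b (k + 1) ≤ b k) (hb0 : ∀ k, m ≤ k → 0 ≤ b k) (D : ℕ → E)
    (h : m ≤ n) :
    ‖∑ k ∈ Finset.Ico m n, b (k + 1) • (D (k + 1) - D k)‖
      ≤ b n * ‖D n‖ + b m * ‖D m‖ + ∑ k ∈ Finset.Ico m n, (b k - b (k + 1)) * ‖D k‖ := by
  rw [sum_smul_sub_by_parts b D h]
  refine (norm_add_le _ _).trans (add_le_add ((norm_sub_le _ _).trans ?_) ?_)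
  · rw [norm_smul, norm_smul, Real.norm_of_nonneg (hb0 _ h), Real.norm_of_nonneg (hb0 _ le_rfl)]
  · refine (norm_sum_le _ _).trans (Finset.sum_le_sum fun k hk => ?_)
    rw [norm_smul, Real.norm_of_nonneg (sub_nonneg.2 (hb k (Finset.mem_Ico.1 hk).1))]

/-! ### A bounded trigonometric polynomial with large partial sums of coefficients -/

lemma expChar_neg (k : ℤ) (x : ℝ) : expChar (-k) x = (starRingEnd ℂ) (expChar k x) := by
  rw [expChar_eq, expChar_eq, ← Complex.exp_conj, map_mul, Complex.conj_ofReal, Complex.conj_I]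
  congr 1
  push_cast; ring

lemma sum_Icc_neg_eq_add_sum_range {M : Type*} [AddCommGroup M] (f : ℤ → M) (n : ℕ) :
    ∑ k ∈ Finset.Icc (-n : ℤ) n, f k
      = f 0 + ∑ j ∈ Finset.range n, (f (j + 1) + f (-(j + 1))) := by
  induction n with
  | zero => simp
  | succ n ih =>
    have := Finset.sum_Icc_succ_eq_add_endpoints f (N := n)
    push_cast
    rw [this, ih, Finset.sum_range_succ]
    abel

lemma norm_expChar_sub_neg_le {k : ℕ} {y : ℝ} (hy : 0 ≤ y) :
    ‖expChar k y - expChar (-k) y‖ ≤ 4 * Real.pi * (k * y) := by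
  have : expChar k y - expChar (-k) y
      = expChar (-k) y * (Complex.exp (Complex.I * ((4 * Real.pi * (k * y) : ℝ) : ℂ)) - 1) := by
    rw [mul_sub, mul_one, expChar, expChar, ← Complex.exp_add]
    congr 2
    push_cast; ring
  rw [this, norm_mul, norm_expChar, one_mul]
  refine (Real.norm_exp_I_mul_ofReal_sub_one_le).trans ?_
  rw [Real.norm_of_nonneg (by positivity)]

lemma norm_sum_inv_smul_expChar_sub_le_of_le_half (n : ℕ) {y : ℝ} (h0 : 0 < y)
    (h1 : y ≤ 1 / 2) :
    ‖∑ j ∈ Finset.range n, ((j : ℝ) + 1)⁻¹ • (expChar (j + 1) y - expChar (-(j + 1)) y)‖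
      ≤ 17 := by
  set m : ℕ := ⌈1 / (2 * y)⌉₊ with hm
  have hm1 : 1 / (2 * y) ≤ m := Nat.le_ceil _
  have hm2 : (m : ℝ) < 1 / (2 * y) + 1 := Nat.ceil_lt_add_one (by positivity)
  have hm0 : 0 < (m : ℝ) := lt_of_lt_of_le (by positivity) hm1
  have hmy : (m : ℝ) * y ≤ 1 := by
    have : (m : ℝ) * y ≤ (1 / (2 * y) + 1) * y := by gcongr
    have h2 : (1 / (2 * y) + 1) * y = 1 / 2 + y := by field_simp
    linarith
  have hmy' : 1 ≤ 2 * (m * y) := by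
    rw [div_le_iff₀ (by positivity)] at hm1; linarith
  have head : ∀ r ≤ m, ‖∑ j ∈ Finset.range r,
      ((j : ℝ) + 1)⁻¹ • (expChar (j + 1) y - expChar (-(j + 1)) y)‖ ≤ 13 := by
    intro r hr
    calc _ ≤ ∑ j ∈ Finset.range r, 4 * Real.pi * y := by
          refine (norm_sum_le _ _).trans (Finset.sum_le_sum fun j _ => ?_)
          have := norm_expChar_sub_neg_le (k := j + 1) h0.le
          push_cast at this
          rw [norm_smul, Real.norm_of_nonneg (by positivity), inv_mul_le_iff₀ (by positivity)]
          linarith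
      _ = r * y * (4 * Real.pi) := by simp; ring
      _ ≤ 1 * (4 * Real.pi) := by
          gcongr
          have : (r : ℝ) * y ≤ m * y := by gcongr
          linarith
      _ ≤ 13 := by linarith [Real.pi_lt_d2]
  rcases le_total n m with hnm | hnm
  · linarith [head n hnm]
  set D : ℕ → ℂ := fun k => ∑ j ∈ Finset.range k, (expChar (j + 1) y - expChar (-(j + 1)) y)
    with hD
  have hDb : ∀ k, ‖D k‖ ≤ 1 / y := by
    intro k
    have e1 : D k = (∑ j ∈ Finset.range k, expChar (1 + j) y)
        - (starRingEnd ℂ) (∑ j ∈ Finset.range k, expChar (1 + j) y) := by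
      simp only [hD, map_sum, ← expChar_neg, Finset.sum_sub_distrib, add_comm]
    rw [e1]
    refine (norm_sub_le _ _).trans ?_
    rw [RCLike.norm_conj]
    have := norm_sum_range_expChar_le h0 h1 1 k
    have h2 : 1 / y = 1 / (2 * y) + 1 / (2 * y) := by field_simp; norm_num
    linarith
  have anti : ∀ k, m ≤ k → ((k + 1 : ℕ) : ℝ)⁻¹ ≤ (k : ℝ)⁻¹ := by
    intro k hk
    have : (0 : ℝ) < k := hm0.trans_le (by exact_mod_cast hk)
    gcongr; simp
  have tail := norm_sum_smul_sub_le (b := fun k : ℕ => (k : ℝ)⁻¹) (m := m) (n := n) anti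
    (fun k _ => by positivity) D hnm
  have tail2 : ‖∑ k ∈ Finset.Ico m n, ((k + 1 : ℕ) : ℝ)⁻¹ • (D (k + 1) - D k)‖ ≤ 4 := by
    refine tail.trans ?_
    have b1 : ∑ k ∈ Finset.Ico m n, ((k : ℝ)⁻¹ - ((k + 1 : ℕ) : ℝ)⁻¹) * ‖D k‖
        ≤ ∑ k ∈ Finset.Ico m n, ((k : ℝ)⁻¹ - ((k + 1 : ℕ) : ℝ)⁻¹) * (1 / y) := by
      refine Finset.sum_le_sum fun k hk => ?_
      have := anti k (Finset.mem_Ico.1 hk).1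
      exact mul_le_mul_of_nonneg_left (hDb k) (by linarith)
    have b2 : ∑ k ∈ Finset.Ico m n, ((k : ℝ)⁻¹ - ((k + 1 : ℕ) : ℝ)⁻¹) = (m : ℝ)⁻¹ - (n : ℝ)⁻¹ := by
      have := Finset.sum_Ico_sub (fun k : ℕ => -(k : ℝ)⁻¹) hnm
      rw [show (m : ℝ)⁻¹ - (n : ℝ)⁻¹ = -(n : ℝ)⁻¹ - -(m : ℝ)⁻¹ by ring, ← this]
      exact Finset.sum_congr rfl fun k _ => by ring
    rw [← Finset.sum_mul, b2] at b1
    have b3 : (n : ℝ)⁻¹ * ‖D n‖ ≤ (n : ℝ)⁻¹ * (1 / y) := by gcongr; exact hDb n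
    have b4 : (m : ℝ)⁻¹ * ‖D m‖ ≤ (m : ℝ)⁻¹ * (1 / y) := by gcongr; exact hDb m
    have b5 : (m : ℝ)⁻¹ * (1 / y) ≤ 2 := by
      rw [inv_mul_le_iff₀ hm0, div_le_iff₀ h0]; linarith
    linarith
  rw [← Finset.sum_range_add_sum_Ico _ hnm]
  refine (norm_add_le _ _).trans ?_
  have := head m le_rfl
  have e2 : ∑ j ∈ Finset.Ico m n, ((j : ℝ) + 1)⁻¹ • (expChar (j + 1) y - expChar (-(j + 1)) y)
      = ∑ k ∈ Finset.Ico m n, ((k + 1 : ℕ) : ℝ)⁻¹ • (D (k + 1) - D k) := by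
    refine Finset.sum_congr rfl fun k _ => ?_
    simp only [hD, Finset.sum_range_succ]
    push_cast
    rw [add_sub_cancel_left]
  rw [e2]; linarith

lemma norm_sum_inv_smul_expChar_sub_le (n : ℕ) {y : ℝ} (h0 : 0 ≤ y) (h1 : y ≤ 1) :
    ‖∑ j ∈ Finset.range n, ((j : ℝ) + 1)⁻¹ • (expChar (j + 1) y - expChar (-(j + 1)) y)‖
      ≤ 17 := by
  rcases h0.eq_or_lt with rfl | h0
  · simp [expChar]
  rcases le_or_gt y (1 / 2) with h | h
  · exact norm_sum_inv_smul_expChar_sub_le_of_le_half n h0 h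
  rcases h1.eq_or_lt with rfl | h1
  · have : ∀ k : ℤ, expChar k 1 = 1 := fun k => by
      simpa [expChar] using expChar_one_sub k 0
    simp [this]
  · have := norm_sum_inv_smul_expChar_sub_le_of_le_half n (y := 1 - y) (by linarith) (by linarith)
    simp only [expChar_one_sub, neg_neg] at this
    rw [← norm_neg, ← Finset.sum_neg_distrib]
    simpa only [← smul_neg, neg_sub] using this

lemma norm_sum_inv_mul_expChar_le (N : ℕ) {y : ℝ} (h0 : 0 ≤ y) (h1 : y ≤ 1) :
    ‖∑ j ∈ Finset.Icc (-N : ℤ) N, (j : ℂ)⁻¹ * expChar (-(N + j)) y‖ ≤ 17 := by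
  have : ∑ j ∈ Finset.Icc (-N : ℤ) N, (j : ℂ)⁻¹ * expChar (-(N + j)) y
      = -expChar (-N) y * ∑ j ∈ Finset.range N,
        ((j : ℝ) + 1)⁻¹ • (expChar (j + 1) y - expChar (-(j + 1)) y) := by
    rw [sum_Icc_neg_eq_add_sum_range, Finset.mul_sum]
    simp only [Int.cast_zero, inv_zero, zero_mul, zero_add]
    refine Finset.sum_congr rfl fun j _ => ?_
    rw [neg_add (N : ℤ) (j + 1), neg_add (N : ℤ) (-(j + 1)), expChar_add, expChar_add, neg_neg,
      Complex.real_smul, Int.cast_neg, inv_neg]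
    push_cast
    ring
  rw [this, norm_mul, norm_neg, norm_expChar, one_mul]
  exact norm_sum_inv_smul_expChar_sub_le N h0 h1

lemma norm_sum_sq_mul_inv_mul_expChar_le {N : ℕ} (hN : 1 ≤ N) {y : ℝ} (h0 : 0 ≤ y)
    (h1 : y ≤ 1) :
    ‖∑ j ∈ Finset.Icc (-N : ℤ) N, ((N : ℂ) + j) ^ 2 * (j : ℂ)⁻¹ * expChar (-(N + j)) y‖
      ≤ 26 * (N : ℝ) ^ 2 := by
  have hN' : (1 : ℝ) ≤ N := by exact_mod_cast hN
  have : ∑ j ∈ Finset.Icc (-N : ℤ) N, ((N : ℂ) + j) ^ 2 * (j : ℂ)⁻¹ * expChar (-(N + j)) y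
      = (N : ℂ) ^ 2 * (∑ j ∈ Finset.Icc (-N : ℤ) N, (j : ℂ)⁻¹ * expChar (-(N + j)) y)
        + ∑ j ∈ Finset.Icc (-N : ℤ) N,
          (2 * N * (if j = 0 then 0 else 1) + (j : ℂ)) * expChar (-(N + j)) y := by
    rw [Finset.mul_sum, ← Finset.sum_add_distrib]
    refine Finset.sum_congr rfl fun j _ => ?_
    split_ifs with hj
    · simp [hj]
    · have : (j : ℂ) ≠ 0 := by exact_mod_cast hj
      field_simp
      ring
  rw [this]
  refine (norm_add_le _ _).trans ?_
  have b1 : ‖(N : ℂ) ^ 2 * (∑ j ∈ Finset.Icc (-N : ℤ) N, (j : ℂ)⁻¹ * expChar (-(N + j)) y)‖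
      ≤ (N : ℝ) ^ 2 * 17 := by
    rw [norm_mul, norm_pow, Complex.norm_natCast]
    gcongr
    exact norm_sum_inv_mul_expChar_le N h0 h1
  have b2 : ‖∑ j ∈ Finset.Icc (-N : ℤ) N,
      (2 * N * (if j = 0 then 0 else 1) + (j : ℂ)) * expChar (-(N + j)) y‖
      ≤ ∑ j ∈ Finset.Icc (-N : ℤ) N, (3 * N : ℝ) := by
    refine (norm_sum_le _ _).trans (Finset.sum_le_sum fun j hj => ?_)
    rw [norm_mul, norm_expChar, mul_one]
    refine (norm_add_le _ _).trans ?_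
    have c1 : ‖(2 * N * (if j = 0 then 0 else 1) : ℂ)‖ ≤ 2 * N := by
      split_ifs <;> simp
    have c2 : ‖(j : ℂ)‖ ≤ N := by
      rw [Complex.norm_intCast]
      rw [Finset.mem_Icc] at hj
      exact_mod_cast abs_le.2 hj
    linarith
  have b3 : ∑ j ∈ Finset.Icc (-N : ℤ) N, (3 * N : ℝ) ≤ 9 * (N : ℝ) ^ 2 := by
    rw [Finset.sum_const, nsmul_eq_mul, Int.card_Icc]
    have : ((N : ℤ) + 1 - -N).toNat = 2 * N + 1 := by omega
    rw [this]; push_cast; nlinarith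
  linarith

/-! ### The lower bound -/

lemma integral_mul_sum_torusChar {d : ℕ} {K : (Fin d → ℝ) → ℂ} (hK : IntegrableOn K (torusBox d))
    {ι : Type*} (s : Finset ι) (c : ι → ℂ) (k : ι → Fin d → ℤ) :
    ∫ x in torusBox d, K x * ∑ p ∈ s, c p * torusChar d (k p) x
      = ∑ p ∈ s, c p * ∫ x in torusBox d, K x * torusChar d (k p) x := by
  simp only [Finset.mul_sum]
  rw [integral_finsetSum]
  · refine Finset.sum_congr rfl fun p _ => ?_
    rw [← integral_const_mul]
    congr 1; ext x; ring
  · intro p _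
    have : Integrable (fun x => c p * (K x * torusChar d (k p) x))
        (volume.restrict (torusBox d)) := by
      refine Integrable.const_mul ?_ _
      exact hK.mul_bdd (c := 1) (continuous_torusChar d _).aestronglyMeasurable
        (Filter.Eventually.of_forall fun x => (norm_torusChar d _ x).le)
    refine this.congr (Filter.Eventually.of_forall fun x => ?_)
    simp only; ring

lemma measurableSet_torusBox (d : ℕ) : MeasurableSet (torusBox d) :=
  MeasurableSet.univ_pi fun _ => measurableSet_Ico

lemma norm_test_polynomial_le {d N : ℕ} (hN : 1 ≤ N) {β : ℝ} (hβ : 0 < β) {y : Fin d → ℝ}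
    (hy : y ∈ torusBox d) :
    ‖∑ p ∈ Fintype.piFinset fun _ : Fin d => Finset.Icc (-N : ℤ) N,
      ((1 + 4 * (Real.pi : ℂ) ^ 2 * β * ∑ i, ((N : ℂ) + p i) ^ 2) * ∏ i, (p i : ℂ)⁻¹)
        * torusChar d (fun i => -(N + p i)) y‖
      ≤ 26 ^ d * (1 + 4 * Real.pi ^ 2 * β * (d * (N : ℝ) ^ 2)) := by
  have hy' : ∀ i, 0 ≤ y i ∧ y i ≤ 1 := fun i => ⟨(hy i trivial).1, (hy i trivial).2.le⟩
  have key : ∑ p ∈ Fintype.piFinset fun _ : Fin d => Finset.Icc (-N : ℤ) N,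
      ((1 + 4 * (Real.pi : ℂ) ^ 2 * β * ∑ i, ((N : ℂ) + p i) ^ 2) * ∏ i, (p i : ℂ)⁻¹)
        * torusChar d (fun i => -(N + p i)) y
      = (∏ i, ∑ j ∈ Finset.Icc (-N : ℤ) N, (j : ℂ)⁻¹ * expChar (-(N + j)) (y i))
        + 4 * (Real.pi : ℂ) ^ 2 * β * ∑ l, ∏ i, ∑ j ∈ Finset.Icc (-N : ℤ) N,
          (if i = l then ((N : ℂ) + j) ^ 2 else 1) * (j : ℂ)⁻¹ * expChar (-(N + j)) (y i) := by
    simp only [Finset.prod_univ_sum, torusChar_eq_prod]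
    rw [Finset.sum_comm, Finset.mul_sum, ← Finset.sum_add_distrib]
    refine Finset.sum_congr rfl fun p _ => ?_
    simp only [Finset.prod_mul_distrib, Finset.prod_ite_eq', Finset.mem_univ, if_true,
      ← Finset.sum_mul]
    ring
  rw [key]
  have b1 : ‖∏ i, ∑ j ∈ Finset.Icc (-N : ℤ) N, (j : ℂ)⁻¹ * expChar (-(N + j)) (y i)‖
      ≤ 26 ^ d := by
    rw [norm_prod]
    calc _ ≤ ∏ i : Fin d, (26 : ℝ) := by
          refine Finset.prod_le_prod (fun _ _ => norm_nonneg _) fun i _ => ?_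
          linarith [norm_sum_inv_mul_expChar_le N (hy' i).1 (hy' i).2]
      _ = 26 ^ d := by simp
  have b2 : ∀ l : Fin d, ‖∏ i, ∑ j ∈ Finset.Icc (-N : ℤ) N,
      (if i = l then ((N : ℂ) + j) ^ 2 else 1) * (j : ℂ)⁻¹ * expChar (-(N + j)) (y i)‖
      ≤ 26 ^ d * (N : ℝ) ^ 2 := by
    intro l
    rw [norm_prod]
    calc _ ≤ ∏ i : Fin d, 26 * (if i = l then (N : ℝ) ^ 2 else 1) := by
          refine Finset.prod_le_prod (fun _ _ => norm_nonneg _) fun i _ => ?_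
          split_ifs
          · exact norm_sum_sq_mul_inv_mul_expChar_le hN (hy' i).1 (hy' i).2
          · simp only [one_mul]
            linarith [norm_sum_inv_mul_expChar_le N (hy' i).1 (hy' i).2]
      _ = 26 ^ d * (N : ℝ) ^ 2 := by rw [Finset.prod_mul_distrib]; simp
  refine (norm_add_le _ _).trans ?_
  rw [norm_mul, mul_add, mul_one]
  refine add_le_add b1 ?_
  have b3 : ‖(4 * (Real.pi : ℂ) ^ 2 * β)‖ = 4 * Real.pi ^ 2 * β := by
    simp [abs_of_pos hβ, abs_of_pos Real.pi_pos]
  rw [b3]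
  calc _ ≤ 4 * Real.pi ^ 2 * β * ∑ l : Fin d, 26 ^ d * (N : ℝ) ^ 2 := by
        gcongr
        exact (norm_sum_le _ _).trans (Finset.sum_le_sum fun l _ => b2 l)
    _ = _ := by simp; ring

lemma sum_inv_Icc_neg (N : ℕ) : ∑ j ∈ Finset.Icc (-N : ℤ) N, (j : ℂ)⁻¹ = 0 := by
  rw [sum_Icc_neg_eq_add_sum_range]
  simp only [Int.cast_zero, inv_zero, zero_add, Int.cast_neg, inv_neg, add_neg_cancel,
    Finset.sum_const_zero]

lemma sum_inv_filter_nonpos (N : ℕ) :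
    ∑ j ∈ Finset.Icc (-N : ℤ) N with j ≤ 0, (j : ℂ)⁻¹ = -((harmonic N : ℝ) : ℂ) := by
  rw [Finset.sum_filter, sum_Icc_neg_eq_add_sum_range, harmonic]
  push_cast
  rw [← Finset.sum_neg_distrib]
  simp only [inv_zero, zero_add]
  refine Finset.sum_congr rfl fun j _ => ?_
  rw [if_neg (by omega), if_pos (by omega), zero_add, ← inv_neg]

lemma log_pow_le_mul_integral_norm {d N : ℕ} (hd : 1 ≤ d) (hN : 1 ≤ N) {β : ℝ} (hβ : 0 < β)
    {K : (Fin d → ℝ) → ℂ} (hK : IntegrableOn K (torusBox d))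
    (hhigh : ∀ k : Fin d → ℤ, (∃ i, (N : ℤ) < |k i|) →
      (∫ x in torusBox d, K x * torusChar d (fun i => -(k i)) x)
        = (((1 + 4 * Real.pi ^ 2 * β * ∑ i, ((k i : ℝ)) ^ 2)⁻¹ : ℝ) : ℂ))
    (hlow : ∀ k : Fin d → ℤ, (∀ i, |k i| ≤ (N : ℤ)) →
      (∫ x in torusBox d, K x * torusChar d (fun i => -(k i)) x) = 0) :
    Real.log (N + 1) ^ d ≤
      26 ^ d * (1 + 4 * Real.pi ^ 2 * β * (d * (N : ℝ) ^ 2)) * ∫ x in torusBox d, ‖K x‖ := by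
  set box := Fintype.piFinset fun _ : Fin d => Finset.Icc (-N : ℤ) N with hbox
  set c : (Fin d → ℤ) → ℂ := fun p =>
    (1 + 4 * (Real.pi : ℂ) ^ 2 * β * ∑ i, ((N : ℂ) + p i) ^ 2) * ∏ i, (p i : ℂ)⁻¹ with hc
  have hterm : ∀ p ∈ box, c p * ∫ x in torusBox d, K x * torusChar d (fun i => -(N + p i)) x
      = (∏ i, (p i : ℂ)⁻¹) - if (∀ i, p i ≤ 0) then ∏ i, (p i : ℂ)⁻¹ else 0 := by
    intro p hp
    have hp' : ∀ i, -(N : ℤ) ≤ p i ∧ p i ≤ N := fun i => by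
      simpa using Fintype.mem_piFinset.1 hp i
    split_ifs with h
    · rw [hlow (fun i => N + p i) fun i => abs_le.2 ⟨by linarith [hp' i], by linarith [h i]⟩]
      simp
    · push Not at h
      obtain ⟨i, hi⟩ := h
      rw [hhigh (fun i => N + p i) ⟨i, lt_abs.2 (Or.inl (by linarith))⟩, sub_zero]
      have hpos : 0 < 1 + 4 * Real.pi ^ 2 * β * ∑ i, (((N + p i : ℤ) : ℝ)) ^ 2 := by positivity
      have hne : ((1 + 4 * Real.pi ^ 2 * β * ∑ i, (((N + p i : ℤ) : ℝ)) ^ 2 : ℝ) : ℂ) ≠ 0 := by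
        exact_mod_cast hpos.ne'
      have hcp : c p = ((1 + 4 * Real.pi ^ 2 * β * ∑ i, (((N + p i : ℤ) : ℝ)) ^ 2 : ℝ) : ℂ)
          * ∏ i, (p i : ℂ)⁻¹ := by
        simp only [hc]; push_cast; rfl
      rw [hcp, Complex.ofReal_inv]
      field_simp
  have hval : ∫ x in torusBox d, K x * ∑ p ∈ box, c p * torusChar d (fun i => -(N + p i)) x
      = -(-((harmonic N : ℝ) : ℂ)) ^ d := by
    rw [integral_mul_sum_torusChar hK, Finset.sum_congr rfl hterm, Finset.sum_sub_distrib,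
      ← Finset.sum_filter, ← Finset.prod_univ_sum (fun _ => Finset.Icc (-N : ℤ) N)
        (fun _ j => (j : ℂ)⁻¹)]
    have : box.filter (fun p => ∀ i, p i ≤ 0)
        = Fintype.piFinset fun _ : Fin d => (Finset.Icc (-N : ℤ) N).filter (· ≤ 0) := by
      ext p
      simp only [hbox, Finset.mem_filter, Fintype.mem_piFinset]
      exact ⟨fun h i => ⟨h.1 i, h.2 i⟩, fun h => ⟨fun i => (h i).1, fun i => (h i).2⟩⟩
    rw [this, ← Finset.prod_univ_sum (fun _ => (Finset.Icc (-N : ℤ) N).filter (· ≤ 0))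
        (fun _ j => (j : ℂ)⁻¹)]
    simp only [sum_inv_Icc_neg, sum_inv_filter_nonpos, Finset.prod_const, Finset.card_univ,
      Fintype.card_fin]
    rw [zero_pow (by omega), zero_sub]
  have hharm : Real.log (N + 1) ≤ (harmonic N : ℝ) := by
    exact_mod_cast log_add_one_le_harmonic N
  have hlog : 0 ≤ Real.log (N + 1 : ℝ) := Real.log_nonneg (by linarith [N.cast_nonneg (α := ℝ)])
  calc Real.log (N + 1) ^ d ≤ (harmonic N : ℝ) ^ d := by gcongr
    _ = ‖∫ x in torusBox d, K x * ∑ p ∈ box, c p * torusChar d (fun i => -(N + p i)) x‖ := by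
        rw [hval, norm_neg, norm_pow, norm_neg, Complex.norm_real,
          Real.norm_of_nonneg (hlog.trans hharm)]
    _ ≤ ∫ x in torusBox d,
          26 ^ d * (1 + 4 * Real.pi ^ 2 * β * (d * (N : ℝ) ^ 2)) * ‖K x‖ := by
        refine norm_integral_le_of_norm_le (hK.norm.const_mul _) ?_
        filter_upwards [ae_restrict_mem (measurableSet_torusBox d)] with x hx
        rw [norm_mul, mul_comm]
        gcongr
        exact norm_test_polynomial_le hN hβ hx
    _ = _ := integral_const_mul _ _

/-! ### The one-dimensional heat kernel and its partial sums -/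

/-- The heat kernel `∑_k e^{-πk²τ} e^{2πikx}` on the circle. -/
def heatKernel (τ x : ℝ) : ℂ := (HurwitzZeta.cosKernel (x : UnitAddCircle) τ : ℂ)

/-- The partial sum over `|k| ≤ n` of the Fourier series of the heat kernel. -/
def heatPartialSum (n : ℕ) (τ x : ℝ) : ℂ :=
  ∑ k ∈ Finset.Icc (-n : ℤ) n, (Real.exp (-Real.pi * k ^ 2 * τ) : ℂ) * expChar k x

lemma hasSum_heatKernel {τ : ℝ} (hτ : 0 < τ) (x : ℝ) :
    HasSum (fun k : ℤ => (Real.exp (-Real.pi * k ^ 2 * τ) : ℂ) * expChar k x)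
      (heatKernel τ x) := by
  have h : (fun k : ℤ => (Real.exp (-Real.pi * k ^ 2 * τ) : ℂ) * expChar k x)
      = fun k : ℤ => Complex.exp (2 * Real.pi * Complex.I * x * k)
        * Real.exp (-Real.pi * k ^ 2 * τ) := by
    ext k
    rw [mul_comm, expChar]
    congr 2
    ring
  rw [h]
  exact HurwitzZeta.hasSum_int_cosKernel x hτ

lemma heatKernel_add_int (τ x : ℝ) (m : ℤ) : heatKernel τ (x + m) = heatKernel τ x := by
  unfold heatKernel
  congr 2
  rw [AddCircle.coe_add, add_eq_left]
  exact (AddCircle.coe_eq_zero_iff 1).2 ⟨m, by simp⟩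

lemma heatPartialSum_add_int (n : ℕ) (τ x : ℝ) (m : ℤ) :
    heatPartialSum n τ (x + m) = heatPartialSum n τ x := by
  simp only [heatPartialSum, expChar_add_int]

lemma cosKernel_nonneg (a : UnitAddCircle) {τ : ℝ} (hτ : 0 < τ) :
    0 ≤ HurwitzZeta.cosKernel a τ := by
  have h := HurwitzZeta.evenKernel_functional_equation a (1 / τ)
  have h0 : 0 ≤ HurwitzZeta.evenKernel a (1 / τ) := by
    induction a using QuotientAddGroup.induction_on with | H a =>
    exact (HurwitzZeta.hasSum_int_evenKernel a (by positivity : 0 < 1 / τ)).nonneg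
      fun n => (Real.exp_pos _).le
  rw [h, one_div_one_div] at h0
  exact nonneg_of_mul_nonneg_right h0 (by positivity)

lemma continuousOn_heatKernel :
    ContinuousOn (fun p : ℝ × ℝ => heatKernel p.1 p.2) (Set.Ioi 0 ×ˢ Set.univ) := by
  simp only [heatKernel, HurwitzZeta.cosKernel_def]
  refine continuousOn_of_forall_continuousAt fun p hp => ?_
  have hp1 : 0 < p.1 := hp.1
  exact (continuousAt_jacobiTheta₂ (p.2 : ℂ) (τ := Complex.I * p.1) (by simpa)).comp
    (f := fun u : ℝ × ℝ => ((u.2 : ℂ), Complex.I * (u.1 : ℂ))) (by fun_prop)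

lemma continuous_heatKernel {τ : ℝ} (hτ : 0 < τ) : Continuous (heatKernel τ) := by
  refine continuousOn_univ.1 ?_
  exact continuousOn_heatKernel.comp (f := fun x : ℝ => (τ, x)) (by fun_prop)
    fun x _ => ⟨hτ, trivial⟩

@[fun_prop] lemma continuous_uncurry_heatPartialSum (n : ℕ) :
    Continuous (fun p : ℝ × ℝ => heatPartialSum n p.1 p.2) := by
  unfold heatPartialSum; fun_prop

@[fun_prop] lemma continuous_heatPartialSum (n : ℕ) (τ : ℝ) :
    Continuous (heatPartialSum n τ) := by
  unfold heatPartialSum; fun_prop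

lemma Continuous.integrableOn_Ico_zero_one {E : Type*} [NormedAddCommGroup E]
    {f : ℝ → E} (hf : Continuous f) : IntegrableOn f (Set.Ico 0 1) :=
  (hf.continuousOn.integrableOn_Icc).mono_set Set.Ico_subset_Icc_self

lemma norm_gauss_mul_expChar (τ : ℝ) (k : ℤ) (x : ℝ) :
    ‖(Real.exp (-Real.pi * k ^ 2 * τ) : ℂ) * expChar k x‖ = Real.exp (-Real.pi * k ^ 2 * τ) := by
  rw [norm_mul, norm_expChar, mul_one, Complex.norm_real, Real.norm_of_nonneg (Real.exp_pos _).le]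

lemma summable_gauss {τ : ℝ} (hτ : 0 < τ) :
    Summable fun k : ℤ => Real.exp (-Real.pi * k ^ 2 * τ) := by
  simpa only [norm_gauss_mul_expChar] using (hasSum_heatKernel hτ 0).summable.norm

lemma integral_gauss_mul_expChar_mul (τ : ℝ) (l k : ℤ) :
    ∫ x in Set.Ico (0 : ℝ) 1, (Real.exp (-Real.pi * l ^ 2 * τ) : ℂ) * expChar l x * expChar (-k) x
      = if l = k then (Real.exp (-Real.pi * k ^ 2 * τ) : ℂ) else 0 := by
  simp only [mul_assoc, ← expChar_add]
  rw [integral_const_mul, integral_expChar]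
  by_cases h : l = k
  · simp [h]
  · rw [if_neg h, if_neg (by omega), mul_zero]

lemma integral_heatKernel_mul_expChar {τ : ℝ} (hτ : 0 < τ) (k : ℤ) :
    ∫ x in Set.Ico (0 : ℝ) 1, heatKernel τ x * expChar (-k) x
      = (Real.exp (-Real.pi * k ^ 2 * τ) : ℂ) := by
  have h := hasSum_integral_of_summable_integral_norm
    (μ := volume.restrict (Set.Ico (0 : ℝ) 1))
    (F := fun (l : ℤ) x => (Real.exp (-Real.pi * l ^ 2 * τ) : ℂ) * expChar l x * expChar (-k) x)
    (fun l => Continuous.integrableOn_Ico_zero_one (by fun_prop)) (by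
      simp only [norm_mul _ (expChar (-k) _), norm_gauss_mul_expChar, norm_expChar, mul_one]
      simpa using summable_gauss hτ)
  simp only [integral_gauss_mul_expChar_mul] at h
  have h2 := h.unique (hasSum_ite_eq k _)
  rw [← h2]
  congr 1
  ext x
  rw [tsum_mul_right, (hasSum_heatKernel hτ x).tsum_eq]

lemma integral_heatPartialSum_mul_expChar (n : ℕ) (τ : ℝ) (k : ℤ) :
    ∫ x in Set.Ico (0 : ℝ) 1, heatPartialSum n τ x * expChar (-k) x
      = if |k| ≤ n then (Real.exp (-Real.pi * k ^ 2 * τ) : ℂ) else 0 := by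
  simp only [heatPartialSum, Finset.sum_mul]
  rw [integral_finsetSum _ fun l _ => Continuous.integrableOn_Ico_zero_one (by fun_prop)]
  simp only [integral_gauss_mul_expChar_mul, Finset.sum_ite_eq', Finset.mem_Icc, abs_le]

lemma integral_norm_heatKernel {τ : ℝ} (hτ : 0 < τ) :
    ∫ x in Set.Ico (0 : ℝ) 1, ‖heatKernel τ x‖ = 1 := by
  have h := integral_heatKernel_mul_expChar hτ 0
  simp only [neg_zero, expChar_zero, mul_one] at h
  simp only [heatKernel, integral_complex_ofReal] at h
  simp only [heatKernel, Complex.norm_real, Real.norm_of_nonneg (cosKernel_nonneg _ hτ)]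
  have h' : (((∫ x in Set.Ico (0 : ℝ) 1, HurwitzZeta.cosKernel (x : UnitAddCircle) τ) : ℝ) : ℂ)
      = (1 : ℝ) := by simpa using h
  exact_mod_cast h'

lemma heatPartialSum_sub (τ x : ℝ) {m n : ℕ} (h : m ≤ n) :
    heatPartialSum n τ x - heatPartialSum m τ x
      = ∑ k ∈ Finset.Ico m n, Real.exp (-Real.pi * ((k + 1 : ℕ) : ℝ) ^ 2 * τ) •
        (dirichletKernel (k + 1) x - dirichletKernel k x) := by
  induction n, h using Nat.le_induction with
  | base => simp
  | succ n h ih =>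
    rw [Finset.sum_Ico_succ_top h, ← ih]
    have e1 := Finset.sum_Icc_succ_eq_add_endpoints
      (fun k : ℤ => (Real.exp (-Real.pi * k ^ 2 * τ) : ℂ) * expChar k x) (N := n)
    have e2 := Finset.sum_Icc_succ_eq_add_endpoints (fun k : ℤ => expChar k x) (N := n)
    simp only [heatPartialSum, dirichletKernel]
    push_cast at e1 e2 ⊢
    rw [e1, e2, Complex.real_smul]
    push_cast
    ring_nf

lemma gauss_antitone {τ : ℝ} (hτ : 0 < τ) (k : ℕ) :
    Real.exp (-Real.pi * ((k + 1 : ℕ) : ℝ) ^ 2 * τ) ≤ Real.exp (-Real.pi * (k : ℝ) ^ 2 * τ) := by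
  refine Real.exp_le_exp.2 ?_
  have : (k : ℝ) ^ 2 ≤ ((k + 1 : ℕ) : ℝ) ^ 2 := by gcongr; simp
  have h2 := mul_le_mul_of_nonneg_left this (mul_pos Real.pi_pos hτ).le
  linarith

lemma integral_norm_heatPartialSum_sub_le {τ : ℝ} (hτ : 0 < τ) {m n : ℕ} (h : m ≤ n) :
    ∫ x in Set.Ico (0 : ℝ) 1, ‖heatPartialSum n τ x - heatPartialSum m τ x‖
      ≤ Real.exp (-Real.pi * (n : ℝ) ^ 2 * τ) * (4 * Real.log (n + 2))
        + Real.exp (-Real.pi * (m : ℝ) ^ 2 * τ) * (4 * Real.log (m + 2))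
        + ∑ k ∈ Finset.Ico m n, (Real.exp (-Real.pi * (k : ℝ) ^ 2 * τ)
          - Real.exp (-Real.pi * ((k + 1 : ℕ) : ℝ) ^ 2 * τ)) * (4 * Real.log (k + 2)) := by
  set b : ℕ → ℝ := fun k => Real.exp (-Real.pi * (k : ℝ) ^ 2 * τ) with hb
  have hD : ∀ k (c : ℝ), Integrable (fun x => c * ‖dirichletKernel k x‖)
      (volume.restrict (Set.Ico (0 : ℝ) 1)) :=
    fun k c => Continuous.integrableOn_Ico_zero_one (by fun_prop)
  calc _ ≤ ∫ x in Set.Ico (0 : ℝ) 1, (b n * ‖dirichletKernel n x‖ + b m * ‖dirichletKernel m x‖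
          + ∑ k ∈ Finset.Ico m n, (b k - b (k + 1)) * ‖dirichletKernel k x‖) := by
        refine integral_mono (Continuous.integrableOn_Ico_zero_one (by fun_prop))
          (Continuous.integrableOn_Ico_zero_one (by fun_prop)) fun x => ?_
        simp only
        rw [heatPartialSum_sub τ x h]
        exact norm_sum_smul_sub_le (b := b) (fun k _ => gauss_antitone hτ k)
          (fun k _ => (Real.exp_pos _).le) (fun k => dirichletKernel k x) h
    _ = b n * (∫ x in Set.Ico (0 : ℝ) 1, ‖dirichletKernel n x‖)
        + b m * (∫ x in Set.Ico (0 : ℝ) 1, ‖dirichletKernel m x‖)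
        + ∑ k ∈ Finset.Ico m n, (b k - b (k + 1)) *
          (∫ x in Set.Ico (0 : ℝ) 1, ‖dirichletKernel k x‖) := by
        have hD2 : Integrable (fun x => b n * ‖dirichletKernel n x‖ + b m * ‖dirichletKernel m x‖)
          (volume.restrict (Set.Ico (0 : ℝ) 1)) := (hD _ _).add (hD _ _)
        rw [integral_add hD2 (integrable_finsetSum _ fun k _ => hD _ _),
          integral_add (hD _ _) (hD _ _), integral_finsetSum _ fun k _ => hD _ _]
        simp only [integral_const_mul]
    _ ≤ _ := by
        refine add_le_add (add_le_add ?_ ?_) (Finset.sum_le_sum fun k _ => ?_)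
        · exact mul_le_mul_of_nonneg_left (integral_norm_dirichletKernel_le n) (Real.exp_pos _).le
        · exact mul_le_mul_of_nonneg_left (integral_norm_dirichletKernel_le m) (Real.exp_pos _).le
        · exact mul_le_mul_of_nonneg_left (integral_norm_dirichletKernel_le k)
            (sub_nonneg.2 (gauss_antitone hτ k))

lemma one_le_two_mul_log_add_two (n : ℕ) : 1 ≤ 2 * Real.log (n + 2) := by
  have : Real.log 2 ≤ Real.log (n + 2) := Real.log_le_log (by norm_num) (by simp)
  linarith [Real.log_two_gt_d9]

lemma integral_norm_heatPartialSum_le {τ : ℝ} (hτ : 0 < τ) (n : ℕ) :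
    ∫ x in Set.Ico (0 : ℝ) 1, ‖heatPartialSum n τ x‖ ≤ 12 * Real.log (n + 2) := by
  have h := integral_norm_heatPartialSum_sub_le hτ n.zero_le
  have h0 : ∀ x, heatPartialSum 0 τ x = 1 := fun x => by simp [heatPartialSum]
  simp only [h0] at h
  have h1 : ∫ x in Set.Ico (0 : ℝ) 1, ‖heatPartialSum n τ x‖
      ≤ ∫ x in Set.Ico (0 : ℝ) 1, (‖heatPartialSum n τ x - 1‖ + 1) := by
    refine integral_mono (Continuous.integrableOn_Ico_zero_one (by fun_prop))
      (Continuous.integrableOn_Ico_zero_one (by fun_prop)) fun x => ?_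
    simpa using norm_add_le (heatPartialSum n τ x - 1) 1
  rw [integral_add (Continuous.integrableOn_Ico_zero_one (by fun_prop))
    (Continuous.integrableOn_Ico_zero_one (by fun_prop))] at h1
  have h2 : ∑ k ∈ Finset.Ico 0 n, (Real.exp (-Real.pi * (k : ℝ) ^ 2 * τ)
      - Real.exp (-Real.pi * ((k + 1 : ℕ) : ℝ) ^ 2 * τ)) * (4 * Real.log (k + 2))
      ≤ ∑ k ∈ Finset.Ico 0 n, (Real.exp (-Real.pi * (k : ℝ) ^ 2 * τ)
      - Real.exp (-Real.pi * ((k + 1 : ℕ) : ℝ) ^ 2 * τ)) * (4 * Real.log (n + 2)) := by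
    refine Finset.sum_le_sum fun k hk => ?_
    have hk' : (k : ℝ) ≤ n := by exact_mod_cast (Finset.mem_Ico.1 hk).2.le
    refine mul_le_mul_of_nonneg_left ?_ (sub_nonneg.2 (gauss_antitone hτ k))
    gcongr
  rw [← Finset.sum_mul, ← Finset.range_eq_Ico,
    Finset.sum_range_sub' (fun k : ℕ => Real.exp (-Real.pi * (k : ℝ) ^ 2 * τ))] at h2
  have h3 : Real.log 2 ≤ Real.log (n + 2) := Real.log_le_log (by norm_num) (by simp)
  have h4 := one_le_two_mul_log_add_two n
  simp at h h1 h2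
  linarith

lemma tendsto_integral_norm_heatPartialSum_sub {τ : ℝ} (hτ : 0 < τ) (m : ℕ) :
    Filter.Tendsto
      (fun n => ∫ x in Set.Ico (0 : ℝ) 1, ‖heatPartialSum n τ x - heatPartialSum m τ x‖)
      Filter.atTop
      (nhds (∫ x in Set.Ico (0 : ℝ) 1, ‖heatKernel τ x - heatPartialSum m τ x‖)) := by
  set S := ∑' k : ℤ, Real.exp (-Real.pi * k ^ 2 * τ) with hS
  have hP : ∀ n x, ‖heatPartialSum n τ x‖ ≤ S := by
    intro n x
    refine (norm_sum_le _ _).trans ?_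
    simp only [norm_gauss_mul_expChar]
    exact (summable_gauss hτ).sum_le_tsum _ fun k _ => (Real.exp_pos _).le
  refine tendsto_integral_of_dominated_convergence (fun _ => S + S)
    (fun n => Continuous.aestronglyMeasurable (by fun_prop))
    (Continuous.integrableOn_Ico_zero_one (by fun_prop)) (fun n => ?_) ?_
  · refine Filter.Eventually.of_forall fun x => ?_
    rw [norm_norm]
    exact (norm_sub_le _ _).trans (add_le_add (hP _ _) (hP _ _))
  · refine Filter.Eventually.of_forall fun x => ?_
    refine (Filter.Tendsto.sub_const ?_ _).norm
    exact (hasSum_heatKernel hτ x).comp (Finset.tendsto_Icc_neg (R := ℤ))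

lemma integral_norm_heatPartialSum_sub_le_of_one_le {τ : ℝ} (hτ : 0 < τ) {m n : ℕ} (hm : 1 ≤ m)
    (h : m ≤ n) (hmτ : 1 ≤ Real.pi * (m : ℝ) ^ 2 * τ) :
    ∫ x in Set.Ico (0 : ℝ) 1, ‖heatPartialSum n τ x - heatPartialSum m τ x‖
      ≤ 16 * Real.log (m + 2) * Real.exp (-Real.pi * (m : ℝ) ^ 2 * τ) := by
  refine (integral_norm_heatPartialSum_sub_le hτ h).trans ?_
  set b : ℕ → ℝ := fun k => Real.exp (-Real.pi * (k : ℝ) ^ 2 * τ) with hb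
  set l : ℕ → ℝ := fun k => 4 * Real.log (k + 2) with hl
  have hm' : (1 : ℝ) ≤ m := by exact_mod_cast hm
  have e1 : ∀ n, m ≤ n → b n * l n + b m * l m + ∑ k ∈ Finset.Ico m n, (b k - b (k + 1)) * l k
      = 2 * (b m * l m) + ∑ k ∈ Finset.Ico m n, b (k + 1) * (l (k + 1) - l k) := by
    intro n h
    induction n, h using Nat.le_induction with
    | base => simp; ring
    | succ n h ih =>
      rw [Finset.sum_Ico_succ_top h, Finset.sum_Ico_succ_top h]
      linarith
  rw [show Real.exp (-Real.pi * (n : ℝ) ^ 2 * τ) * (4 * Real.log (n + 2))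
        + Real.exp (-Real.pi * (m : ℝ) ^ 2 * τ) * (4 * Real.log (m + 2))
        + ∑ k ∈ Finset.Ico m n, (Real.exp (-Real.pi * (k : ℝ) ^ 2 * τ)
          - Real.exp (-Real.pi * ((k + 1 : ℕ) : ℝ) ^ 2 * τ)) * (4 * Real.log (k + 2))
      = b n * l n + b m * l m + ∑ k ∈ Finset.Ico m n, (b k - b (k + 1)) * l k from rfl, e1 n h]
  set r : ℝ := Real.exp (-(Real.pi * m * τ)) with hr
  have hpos : 0 < Real.pi * m * τ := by positivity
  have hr0 : 0 < r := Real.exp_pos _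
  have hr1 : r < 1 := Real.exp_lt_one_iff.2 (by linarith)
  have e2 : ∀ k ∈ Finset.Ico m n, b (k + 1) * (l (k + 1) - l k)
      ≤ b m * (4 / m) * r ^ (k - m + 1) := by
    intro k hk
    have hk' := (Finset.mem_Ico.1 hk).1
    have hkr : (m : ℝ) ≤ k := by exact_mod_cast hk'
    have f1 : b (k + 1) ≤ b m * r ^ (k - m + 1) := by
      simp only [hb, hr]
      rw [← Real.exp_nat_mul, ← Real.exp_add]
      refine Real.exp_le_exp.2 ?_
      push_cast [Nat.cast_sub hk']
      have : (m : ℝ) ^ 2 + (k - m + 1) * m ≤ (k + 1) ^ 2 := by nlinarith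
      have := mul_le_mul_of_nonneg_left this (mul_pos Real.pi_pos hτ).le
      linarith
    have f2 : l (k + 1) - l k ≤ 4 / m := by
      simp only [hl]
      push_cast
      rw [← mul_sub, ← Real.log_div (by positivity) (by positivity)]
      have := Real.log_le_sub_one_of_pos (x := ((k : ℝ) + 1 + 2) / (k + 2)) (by positivity)
      have g : ((k : ℝ) + 1 + 2) / (k + 2) - 1 = 1 / (k + 2) := by field_simp; ring
      have g2 : 1 / ((k : ℝ) + 2) ≤ 1 / m := by gcongr; linarith
      have g3 : 4 / (m : ℝ) = 4 * (1 / m) := by ring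
      rw [g3]; linarith
    calc b (k + 1) * (l (k + 1) - l k) ≤ b (k + 1) * (4 / m) :=
          mul_le_mul_of_nonneg_left f2 (Real.exp_pos _).le
      _ ≤ b m * r ^ (k - m + 1) * (4 / m) := by gcongr
      _ = _ := by ring
  have e3 : ∑ k ∈ Finset.Ico m n, r ^ (k - m + 1) ≤ m := by
    rw [Finset.sum_Ico_eq_sum_range]
    simp only [Nat.add_sub_cancel_left, pow_succ]
    rw [← Finset.sum_mul]
    have g1 : ∑ i ∈ Finset.range (n - m), r ^ i ≤ (1 - r)⁻¹ := by
      have := (summable_geometric_of_lt_one hr0.le hr1).sum_le_tsum (Finset.range (n - m))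
        fun i _ => by positivity
      rwa [tsum_geometric_of_lt_one hr0.le hr1] at this
    have g2 : r * (1 + Real.pi * m * τ) ≤ 1 := by
      have := Real.add_one_le_exp (Real.pi * m * τ)
      calc r * (1 + Real.pi * m * τ) ≤ r * Real.exp (Real.pi * m * τ) := by gcongr; linarith
        _ = 1 := by rw [hr, ← Real.exp_add]; simp
    have g3 : (1 - r)⁻¹ * r ≤ m := by
      rw [inv_mul_le_iff₀ (by linarith)]
      have g4 : r * (Real.pi * m * τ) * m ≤ (1 - r) * m := by gcongr; linarith
      have g5 : r * 1 ≤ r * (Real.pi * m ^ 2 * τ) := by gcongr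
      nlinarith
    exact (mul_le_mul_of_nonneg_right g1 hr0.le).trans g3
  have e4 : ∑ k ∈ Finset.Ico m n, b (k + 1) * (l (k + 1) - l k) ≤ 4 * b m := by
    refine (Finset.sum_le_sum e2).trans ?_
    rw [← Finset.mul_sum]
    have hbm : 0 < b m := Real.exp_pos _
    calc b m * (4 / m) * _ ≤ b m * (4 / m) * m := by gcongr
      _ = 4 * b m := by field_simp
  have hbm : 0 < b m := Real.exp_pos _
  have h5 := mul_le_mul_of_nonneg_left (one_le_two_mul_log_add_two m) hbm.le
  have : 2 * (b m * l m) + 4 * b m ≤ 16 * Real.log (m + 2) * b m := by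
    simp only [hl]; linarith
  linarith

lemma integral_norm_heatKernel_sub_le {τ : ℝ} (hτ : 0 < τ) {m : ℕ} (hm : 1 ≤ m) :
    ∫ x in Set.Ico (0 : ℝ) 1, ‖heatKernel τ x - heatPartialSum m τ x‖
      ≤ 39 * Real.log (m + 2) * Real.exp (-Real.pi * (m : ℝ) ^ 2 * τ) := by
  have hlog := one_le_two_mul_log_add_two m
  rcases le_total 1 (Real.pi * (m : ℝ) ^ 2 * τ) with h | h
  · refine (le_of_tendsto (tendsto_integral_norm_heatPartialSum_sub hτ m)
      (Filter.eventually_atTop.2 ⟨m, fun n hn =>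
        integral_norm_heatPartialSum_sub_le_of_one_le hτ hm hn h⟩)).trans ?_
    gcongr
    · linarith
    · norm_num
  · have hH := Continuous.integrableOn_Ico_zero_one (continuous_heatKernel hτ)
    have hP := Continuous.integrableOn_Ico_zero_one (continuous_heatPartialSum m τ)
    have h1 : ∫ x in Set.Ico (0 : ℝ) 1, ‖heatKernel τ x - heatPartialSum m τ x‖
        ≤ ∫ x in Set.Ico (0 : ℝ) 1, (‖heatKernel τ x‖ + ‖heatPartialSum m τ x‖) :=
      integral_mono (hH.sub hP).norm (hH.norm.add hP.norm) fun x => norm_sub_le _ _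
    rw [integral_add hH.norm hP.norm, integral_norm_heatKernel hτ] at h1
    have h2 := integral_norm_heatPartialSum_le hτ m
    have h3 : Real.exp (-1) ≤ Real.exp (-Real.pi * (m : ℝ) ^ 2 * τ) :=
      Real.exp_le_exp.2 (by linarith)
    have h4 : 14 / 39 ≤ Real.exp (-1) := by
      rw [Real.exp_neg, le_inv_comm₀ (by norm_num) (Real.exp_pos _)]
      linarith [Real.exp_one_lt_d9]
    calc _ ≤ 14 * Real.log (m + 2) := by linarith
      _ = 39 * Real.log (m + 2) * (14 / 39) := by ring
      _ ≤ _ := mul_le_mul_of_nonneg_left (h4.trans h3) (by linarith)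

/-! ### The part of the heat kernel on the torus with frequencies outside a cube -/

lemma volume_restrict_torusBox (d : ℕ) :
    volume.restrict (torusBox d)
      = Measure.pi fun _ : Fin d => volume.restrict (Set.Ico (0 : ℝ) 1) := by
  rw [torusBox, volume_pi, Measure.restrict_pi_pi]

lemma prod_sub_prod_eq_sum {R : Type*} [CommRing R] {d : ℕ} (f g : Fin d → R) :
    ∏ i, f i - ∏ i, g i
      = ∑ i, ∏ j, if j < i then g j else if j = i then f j - g j else f j := by
  induction d with
  | zero => simp
  | succ d ih =>
    have h := ih (fun i => f i.succ) (fun i => g i.succ)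
    rw [Fin.sum_univ_succ]
    simp only [Fin.prod_univ_succ, Fin.succ_lt_succ_iff, Fin.succ_inj, Fin.not_lt_zero, if_false,
      if_true, Fin.succ_ne_zero, Fin.succ_pos, ← Finset.mul_sum]
    rw [← h]
    ring

/-- The part of the heat kernel on the torus with frequencies `k` satisfying `|k|_∞ > N`. -/
def heatTail (d N : ℕ) (τ : ℝ) (x : Fin d → ℝ) : ℂ :=
  ∏ i, heatKernel τ (x i) - ∏ i, heatPartialSum N τ (x i)

lemma heatTail_add_int (d N : ℕ) (τ : ℝ) (x : Fin d → ℝ) (m : Fin d → ℤ) :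
    heatTail d N τ (fun i => x i + m i) = heatTail d N τ x := by
  simp only [heatTail, heatKernel_add_int, heatPartialSum_add_int]

lemma continuousOn_heatTail (d N : ℕ) :
    ContinuousOn (fun p : (Fin d → ℝ) × ℝ => heatTail d N p.2 p.1) (Set.univ ×ˢ Set.Ioi 0) := by
  refine ContinuousOn.sub (continuousOn_finsetProd _ fun i _ => ?_)
    (continuousOn_finsetProd _ fun i _ => ?_)
  · exact continuousOn_heatKernel.comp (f := fun p : (Fin d → ℝ) × ℝ => (p.2, p.1 i))
      (by fun_prop) fun p hp => ⟨hp.2, trivial⟩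
  · exact ((continuous_uncurry_heatPartialSum N).comp
      (f := fun p : (Fin d → ℝ) × ℝ => (p.2, p.1 i)) (by fun_prop)).continuousOn

lemma continuous_heatTail (d N : ℕ) {τ : ℝ} (hτ : 0 < τ) : Continuous (heatTail d N τ) := by
  have := continuous_heatKernel hτ
  unfold heatTail
  fun_prop

lemma integrableOn_heatTail (d N : ℕ) {τ : ℝ} (hτ : 0 < τ) :
    IntegrableOn (heatTail d N τ) (torusBox d) :=
  ((continuous_heatTail d N hτ).continuousOn.integrableOn_compact
    (isCompact_univ_pi fun _ => isCompact_Icc (a := (0 : ℝ)) (b := 1))).mono_set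
    (Set.pi_mono fun _ _ => Set.Ico_subset_Icc_self)

lemma integral_heatTail_mul_torusChar (d N : ℕ) {τ : ℝ} (hτ : 0 < τ) (k : Fin d → ℤ) :
    ∫ x in torusBox d, heatTail d N τ x * torusChar d (fun i => -(k i)) x
      = if ∀ i, |k i| ≤ N then 0 else (Real.exp (-Real.pi * τ * ∑ i, (k i : ℝ) ^ 2) : ℂ) := by
  have hH := continuous_heatKernel hτ
  simp only [heatTail, torusChar_eq_prod, sub_mul, ← Finset.prod_mul_distrib]
  have i1 : Integrable (fun x : Fin d → ℝ => ∏ i, heatKernel τ (x i) * expChar (-(k i)) (x i))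
      (volume.restrict (torusBox d)) := by
    rw [volume_restrict_torusBox]
    exact Integrable.fintype_prod (f := fun i y => heatKernel τ y * expChar (-(k i)) y)
      fun i => Continuous.integrableOn_Ico_zero_one (by fun_prop)
  have i2 : Integrable
      (fun x : Fin d → ℝ => ∏ i, heatPartialSum N τ (x i) * expChar (-(k i)) (x i))
      (volume.restrict (torusBox d)) := by
    rw [volume_restrict_torusBox]
    exact Integrable.fintype_prod (f := fun i y => heatPartialSum N τ y * expChar (-(k i)) y)
      fun i => Continuous.integrableOn_Ico_zero_one (by fun_prop)
  rw [integral_sub i1 i2, volume_restrict_torusBox,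
    integral_fintype_prod_eq_prod (fun i y => heatKernel τ y * expChar (-(k i)) y),
    integral_fintype_prod_eq_prod (fun i y => heatPartialSum N τ y * expChar (-(k i)) y)]
  simp only [integral_heatKernel_mul_expChar hτ, integral_heatPartialSum_mul_expChar]
  split_ifs with h
  · simp [h]
  · push Not at h
    obtain ⟨i, hi⟩ := h
    have h0 : ∏ i, (if |k i| ≤ N then (Real.exp (-Real.pi * (k i : ℝ) ^ 2 * τ) : ℂ) else 0) = 0 :=
      Finset.prod_eq_zero (Finset.mem_univ i) (if_neg hi.not_ge)
    rw [h0, sub_zero, ← Complex.ofReal_prod, ← Real.exp_sum, Finset.mul_sum]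
    congr 3
    ext j
    ring

lemma integral_norm_heatTail_le (d : ℕ) {N : ℕ} (hN : 1 ≤ N) {τ : ℝ} (hτ : 0 < τ) :
    ∫ x in torusBox d, ‖heatTail d N τ x‖
      ≤ d * (39 * Real.log (N + 2)) ^ d * Real.exp (-Real.pi * (N : ℝ) ^ 2 * τ) := by
  have hH := continuous_heatKernel hτ
  have hlog := one_le_two_mul_log_add_two N
  set F : Fin d → Fin d → ℝ → ℂ := fun i j y =>
    if j < i then heatPartialSum N τ y
    else if j = i then heatKernel τ y - heatPartialSum N τ y else heatKernel τ y with hF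
  have hFc : ∀ i j, Continuous (F i j) := by
    intro i j
    simp only [hF]
    split_ifs <;> fun_prop
  have hFi : ∀ i, Integrable (fun x : Fin d → ℝ => ∏ j, ‖F i j (x j)‖)
      (volume.restrict (torusBox d)) := by
    intro i
    rw [volume_restrict_torusBox]
    exact Integrable.fintype_prod (f := fun j y => ‖F i j y‖)
      fun j => Continuous.integrableOn_Ico_zero_one (hFc i j).norm
  have hFn : ∀ i, ∫ x in torusBox d, ∏ j, ‖F i j (x j)‖
      ≤ (39 * Real.log (N + 2)) ^ d * Real.exp (-Real.pi * (N : ℝ) ^ 2 * τ) := by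
    intro i
    rw [volume_restrict_torusBox, integral_fintype_prod_eq_prod (fun j y => ‖F i j y‖)]
    calc _ ≤ ∏ j, 39 * Real.log (N + 2) *
          (if j = i then Real.exp (-Real.pi * (N : ℝ) ^ 2 * τ) else 1) := by
          refine Finset.prod_le_prod (fun j _ => by positivity) fun j _ => ?_
          simp only [hF]
          rcases lt_trichotomy j i with h | h | h
          · simp only [h, h.ne, if_true, if_false]
            linarith [integral_norm_heatPartialSum_le hτ N]
          · simp only [h, lt_irrefl, if_true, if_false]
            exact integral_norm_heatKernel_sub_le hτ hN
          · simp only [h.not_gt, h.ne', if_false, integral_norm_heatKernel hτ]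
            linarith
      _ = _ := by
          rw [Finset.prod_mul_distrib]
          simp
  calc _ ≤ ∫ x in torusBox d, ∑ i, ∏ j, ‖F i j (x j)‖ := by
        refine integral_mono (integrableOn_heatTail d N hτ).norm
          (integrable_finsetSum _ fun i _ => hFi i) fun x => ?_
        simp only [heatTail, prod_sub_prod_eq_sum, ← norm_prod]
        exact norm_sum_le _ _
    _ = ∑ i, ∫ x in torusBox d, ∏ j, ‖F i j (x j)‖ := integral_finsetSum _ fun i _ => hFi i
    _ ≤ ∑ i : Fin d, (39 * Real.log (N + 2)) ^ d * Real.exp (-Real.pi * (N : ℝ) ^ 2 * τ) :=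
        Finset.sum_le_sum fun i _ => hFn i
    _ = _ := by simp [mul_assoc]

/-! ### The kernel as a Laplace transform of the heat kernel -/

/-- The kernel with Fourier coefficients `(1 + 4π²β|k|²)⁻¹` for `|k|_∞ > N`, and `0` otherwise. -/
def resolventTail (d N : ℕ) (β : ℝ) (x : Fin d → ℝ) : ℂ :=
  ∫ t in Set.Ioi (0 : ℝ), (Real.exp (-t) : ℂ) * heatTail d N (4 * Real.pi * β * t) x

lemma resolventTail_add_int (d N : ℕ) (β : ℝ) (x : Fin d → ℝ) (m : Fin d → ℤ) :
    resolventTail d N β (fun i => x i + m i) = resolventTail d N β x := by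
  simp only [resolventTail, heatTail_add_int]

lemma integral_exp_neg_one_add_mul {a : ℝ} (ha : 0 ≤ a) :
    ∫ t in Set.Ioi (0 : ℝ), Real.exp (-(1 + a) * t) = (1 + a)⁻¹ := by
  rw [integral_exp_mul_Ioi (by linarith)]
  rw [mul_zero, Real.exp_zero, neg_div_neg_eq, one_div]

lemma integral_norm_exp_mul_heatTail_le (d : ℕ) {N : ℕ} (hN : 1 ≤ N) {β t : ℝ} (hβ : 0 < β)
    (ht : 0 < t) :
    ∫ x in torusBox d, ‖(Real.exp (-t) : ℂ) * heatTail d N (4 * Real.pi * β * t) x‖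
      ≤ d * (39 * Real.log (N + 2)) ^ d
        * Real.exp (-(1 + 4 * Real.pi ^ 2 * β * (N : ℝ) ^ 2) * t) := by
  simp only [norm_mul, Complex.norm_real, Real.norm_of_nonneg (Real.exp_pos _).le]
  rw [integral_const_mul]
  calc _ ≤ Real.exp (-t) * (d * (39 * Real.log (N + 2)) ^ d
        * Real.exp (-Real.pi * (N : ℝ) ^ 2 * (4 * Real.pi * β * t))) := by
        gcongr
        exact integral_norm_heatTail_le d hN (by have := Real.pi_pos; positivity)
    _ = d * (39 * Real.log (N + 2)) ^ d * (Real.exp (-t) *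
        Real.exp (-Real.pi * (N : ℝ) ^ 2 * (4 * Real.pi * β * t))) := by ring
    _ = _ := by
        rw [← Real.exp_add]
        congr 2
        ring

lemma integrable_exp_mul_heatTail (d : ℕ) {N : ℕ} (hN : 1 ≤ N) {β : ℝ} (hβ : 0 < β) :
    Integrable (fun p : (Fin d → ℝ) × ℝ =>
        (Real.exp (-p.2) : ℂ) * heatTail d N (4 * Real.pi * β * p.2) p.1)
      ((volume.restrict (torusBox d)).prod (volume.restrict (Set.Ioi 0))) := by
  have hπ := Real.pi_pos
  have hmeas : AEStronglyMeasurable (fun p : (Fin d → ℝ) × ℝ =>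
        (Real.exp (-p.2) : ℂ) * heatTail d N (4 * Real.pi * β * p.2) p.1)
      ((volume.restrict (torusBox d)).prod (volume.restrict (Set.Ioi 0))) := by
    rw [Measure.prod_restrict]
    refine ContinuousOn.aestronglyMeasurable ?_
      ((measurableSet_torusBox d).prod measurableSet_Ioi)
    refine ContinuousOn.mul (by fun_prop) ?_
    refine (continuousOn_heatTail d N).comp
      (f := fun p : (Fin d → ℝ) × ℝ => (p.1, 4 * Real.pi * β * p.2)) (by fun_prop)
      fun p hp => ⟨trivial, ?_⟩
    have : 0 < p.2 := hp.2
    exact Set.mem_Ioi.2 (by positivity)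
  refine (integrable_prod_iff' hmeas).2 ⟨?_, ?_⟩
  · filter_upwards [ae_restrict_mem measurableSet_Ioi] with t ht
    have : 0 < t := ht
    exact (integrableOn_heatTail d N (by positivity)).const_mul _
  · refine Integrable.mono' ((integrableOn_exp_mul_Ioi
      (a := -(1 + 4 * Real.pi ^ 2 * β * (N : ℝ) ^ 2)) (by
        have : 0 < 1 + 4 * Real.pi ^ 2 * β * (N : ℝ) ^ 2 := by positivity
        linarith) 0).const_mul (d * (39 * Real.log (N + 2)) ^ d))
      hmeas.norm.prod_swap.integral_prod_right' ?_
    filter_upwards [ae_restrict_mem measurableSet_Ioi] with t ht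
    rw [Real.norm_of_nonneg (integral_nonneg fun x => norm_nonneg _)]
    exact integral_norm_exp_mul_heatTail_le d hN hβ ht

lemma integrableOn_resolventTail (d : ℕ) {N : ℕ} (hN : 1 ≤ N) {β : ℝ} (hβ : 0 < β) :
    IntegrableOn (resolventTail d N β) (torusBox d) :=
  (integrable_exp_mul_heatTail d hN hβ).integral_prod_left

lemma integral_norm_resolventTail_le (d : ℕ) {N : ℕ} (hN : 1 ≤ N) {β : ℝ} (hβ : 0 < β) :
    ∫ x in torusBox d, ‖resolventTail d N β x‖
      ≤ d * (39 * Real.log (N + 2)) ^ d * (1 + 4 * Real.pi ^ 2 * β * (N : ℝ) ^ 2)⁻¹ := by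
  have hI := integrable_exp_mul_heatTail d hN hβ
  calc _ ≤ ∫ x in torusBox d, ∫ t in Set.Ioi (0 : ℝ),
          ‖(Real.exp (-t) : ℂ) * heatTail d N (4 * Real.pi * β * t) x‖ :=
        integral_mono (integrableOn_resolventTail d hN hβ).norm hI.norm.integral_prod_left
          fun x => norm_integral_le_integral_norm _
    _ = ∫ t in Set.Ioi (0 : ℝ), ∫ x in torusBox d,
          ‖(Real.exp (-t) : ℂ) * heatTail d N (4 * Real.pi * β * t) x‖ :=
        integral_integral_swap hI.norm
    _ ≤ ∫ t in Set.Ioi (0 : ℝ), d * (39 * Real.log (N + 2)) ^ d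
        * Real.exp (-(1 + 4 * Real.pi ^ 2 * β * (N : ℝ) ^ 2) * t) := by
        have hpos : 0 < 1 + 4 * Real.pi ^ 2 * β * (N : ℝ) ^ 2 := by positivity
        exact setIntegral_mono_on hI.integral_norm_prod_right
          ((integrableOn_exp_mul_Ioi (by linarith) 0).const_mul _) measurableSet_Ioi
          fun t ht => integral_norm_exp_mul_heatTail_le d hN hβ ht
    _ = _ := by rw [integral_const_mul, integral_exp_neg_one_add_mul (by positivity)]

lemma integral_resolventTail_mul_torusChar (d : ℕ) {N : ℕ} (hN : 1 ≤ N) {β : ℝ} (hβ : 0 < β)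
    (k : Fin d → ℤ) :
    ∫ x in torusBox d, resolventTail d N β x * torusChar d (fun i => -(k i)) x
      = if ∀ i, |k i| ≤ N then 0
        else (((1 + 4 * Real.pi ^ 2 * β * ∑ i, (k i : ℝ) ^ 2)⁻¹ : ℝ) : ℂ) := by
  have hπ := Real.pi_pos
  have hI : Integrable (fun p : (Fin d → ℝ) × ℝ =>
        (Real.exp (-p.2) : ℂ) * heatTail d N (4 * Real.pi * β * p.2) p.1
          * torusChar d (fun i => -(k i)) p.1)
      ((volume.restrict (torusBox d)).prod (volume.restrict (Set.Ioi 0))) :=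
    (integrable_exp_mul_heatTail d hN hβ).mul_bdd (c := 1)
      ((continuous_torusChar d _).comp continuous_fst).aestronglyMeasurable
      (Filter.Eventually.of_forall fun p => (norm_torusChar d _ _).le)
  simp only [resolventTail, ← integral_mul_const]
  rw [integral_integral_swap hI]
  have h : ∀ t ∈ Set.Ioi (0 : ℝ), ∫ x in torusBox d,
      (Real.exp (-t) : ℂ) * heatTail d N (4 * Real.pi * β * t) x
        * torusChar d (fun i => -(k i)) x
      = if ∀ i, |k i| ≤ N then 0
        else (Real.exp (-(1 + 4 * Real.pi ^ 2 * β * ∑ i, (k i : ℝ) ^ 2) * t) : ℂ) := by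
    intro t ht
    have ht' : 0 < t := ht
    simp only [mul_assoc (Real.exp (-t) : ℂ)]
    rw [integral_const_mul, integral_heatTail_mul_torusChar d N (by positivity)]
    split_ifs with h
    · simp
    · rw [← Complex.ofReal_mul, ← Real.exp_add]
      congr 2
      ring
  rw [setIntegral_congr_fun measurableSet_Ioi h]
  split_ifs with h
  · simp
  · rw [integral_complex_ofReal, integral_exp_neg_one_add_mul (by positivity)]

/-- There exist constants `c₁ > 0` and `c₂ > 0` depending only on the
dimension `d` such that for every `β > 0` and every integer `N ≥ 2`, the kernel `K_{>N,β}`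
(the L¹ function on `𝕋^d` with Fourier coefficients `(1 + 4π²β|k|²)⁻¹` for `|k|_∞ > N`
and `0` otherwise) satisfies
`c₁ (1 + βN²)⁻¹ (log (N+2))^d ≤ ‖K_{>N,β}‖_{L¹(𝕋^d)} ≤ c₂ (1 + βN²)⁻¹ (log (N+2))^d`. -/
theorem statement0 (d : ℕ) (hd : 1 ≤ d) :
    ∃ c₁ c₂ : ℝ, 0 < c₁ ∧ 0 < c₂ ∧
      ∀ β : ℝ, 0 < β → ∀ N : ℕ, 2 ≤ N →
        ∃ K : (Fin d → ℝ) → ℂ,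
          IntegrableOn K (torusBox d) ∧
          (∀ (m : Fin d → ℤ) (x : Fin d → ℝ), K (fun i => x i + (m i : ℝ)) = K x) ∧
          (∀ k : Fin d → ℤ, (∃ i, (N : ℤ) < |k i|) →
            (∫ x in torusBox d, K x * torusChar d (fun i => -(k i)) x)
              = (((1 + 4 * Real.pi ^ 2 * β * ∑ i, ((k i : ℝ)) ^ 2)⁻¹ : ℝ) : ℂ)) ∧
          (∀ k : Fin d → ℤ, (∀ i, |k i| ≤ (N : ℤ)) →
            (∫ x in torusBox d, K x * torusChar d (fun i => -(k i)) x) = 0) ∧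
          c₁ * (1 + β * (N : ℝ) ^ 2)⁻¹ * Real.log ((N : ℝ) + 2) ^ d
              ≤ ∫ x in torusBox d, ‖K x‖ ∧
          (∫ x in torusBox d, ‖K x‖)
              ≤ c₂ * (1 + β * (N : ℝ) ^ 2)⁻¹ * Real.log ((N : ℝ) + 2) ^ d := by
  have hπ := Real.pi_gt_three
  have hd' : (1 : ℝ) ≤ d := by exact_mod_cast hd
  refine ⟨(52 ^ d * (4 * Real.pi ^ 2 * d))⁻¹, d * 39 ^ d, by positivity, by positivity,
    fun β hβ N hN => ⟨resolventTail d N β, ?_⟩⟩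
  have hN1 : 1 ≤ N := by omega
  have hN' : (1 : ℝ) ≤ N := by exact_mod_cast hN1
  have hint := integrableOn_resolventTail d hN1 hβ
  have hcoeff := integral_resolventTail_mul_torusChar d hN1 hβ
  have hhigh : ∀ k : Fin d → ℤ, (∃ i, (N : ℤ) < |k i|) →
      (∫ x in torusBox d, resolventTail d N β x * torusChar d (fun i => -(k i)) x)
        = (((1 + 4 * Real.pi ^ 2 * β * ∑ i, ((k i : ℝ)) ^ 2)⁻¹ : ℝ) : ℂ) := fun k hk => by
    rw [hcoeff, if_neg (by push Not; exact hk)]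
  have hlow : ∀ k : Fin d → ℤ, (∀ i, |k i| ≤ (N : ℤ)) →
      (∫ x in torusBox d, resolventTail d N β x * torusChar d (fun i => -(k i)) x) = 0 :=
    fun k hk => by rw [hcoeff, if_pos hk]
  have hA : 0 < β * (N : ℝ) ^ 2 := by positivity
  have hlog : 0 ≤ Real.log ((N : ℝ) + 2) := Real.log_nonneg (by linarith)
  have hπ2 : 1 ≤ 4 * Real.pi ^ 2 := by nlinarith
  refine ⟨hint, fun m x => resolventTail_add_int d N β x m, hhigh, hlow, ?_, ?_⟩
  · have h := log_pow_le_mul_integral_norm hd hN1 hβ hint hhigh hlow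
    set I := ∫ x in torusBox d, ‖resolventTail d N β x‖
    have hI : 0 ≤ I := integral_nonneg fun x => norm_nonneg _
    have hlog2 : Real.log ((N : ℝ) + 2) ≤ 2 * Real.log (N + 1) := by
      have h2 : 2 * Real.log ((N : ℝ) + 1) = Real.log (((N : ℝ) + 1) ^ 2) := by
        rw [Real.log_pow]; norm_num
      rw [h2]
      exact Real.log_le_log (by positivity) (by nlinarith)
    have hfac : 1 + 4 * Real.pi ^ 2 * β * (d * (N : ℝ) ^ 2)
        ≤ 4 * Real.pi ^ 2 * d * (1 + β * (N : ℝ) ^ 2) := by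
      have : 1 ≤ 4 * Real.pi ^ 2 * d := one_le_mul_of_one_le_of_one_le hπ2 hd'
      linarith
    have hkey : Real.log ((N : ℝ) + 2) ^ d
        ≤ 52 ^ d * (4 * Real.pi ^ 2 * d) * (1 + β * (N : ℝ) ^ 2) * I :=
      calc Real.log ((N : ℝ) + 2) ^ d ≤ (2 * Real.log (N + 1)) ^ d := by gcongr
        _ = 2 ^ d * Real.log (N + 1) ^ d := mul_pow _ _ _
        _ ≤ 2 ^ d * (26 ^ d * (1 + 4 * Real.pi ^ 2 * β * (d * (N : ℝ) ^ 2)) * I) := by gcongr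
        _ ≤ 2 ^ d * (26 ^ d * (4 * Real.pi ^ 2 * d * (1 + β * (N : ℝ) ^ 2)) * I) := by gcongr
        _ = (2 * 26) ^ d * (4 * Real.pi ^ 2 * d) * (1 + β * (N : ℝ) ^ 2) * I := by
            rw [mul_pow]; ring
        _ = _ := by norm_num
    rw [← mul_inv, inv_mul_le_iff₀ (by positivity)]
    exact hkey
  · calc _ ≤ _ := integral_norm_resolventTail_le d hN1 hβ
      _ ≤ d * (39 * Real.log (N + 2)) ^ d * (1 + β * (N : ℝ) ^ 2)⁻¹ := by
          gcongr
          nlinarith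
      _ = _ := by rw [mul_pow]; ring

end
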